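/- arXiv:2010.03540 — 2 statements merged into one kernel-verified Lean document; each statement's English description precedes it below -/
import Mathlib

section
/- Let w, u : ℕ → ℝ be strictly positive weight sequences, both satisfying the radius condition. Suppose φ : 𝔻 → 𝔻 is a bijection of the open unit disk, α ∈ ℂ with α ≠ 0, and S : H_u → H_w is a continuous linear equivalence (bounded bijective linear map with bounded inverse) such that for every h ∈ H_u and every z ∈ 𝔻 one has (S h)^(z) = α · ĥ(φ(z)) (i.e., S is α times the composition operator with φ). Then there exist ε, M > 0 such that ε < w_n / u_n < M for all n ∈ ℕ. -/
/-- Membership in the weighted Hardy space `H_w`: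
sequences `a : ℕ → ℂ` with `∑ w n * |a n|² < ∞`. -/
def memHardy (w : ℕ → ℝ) (a : ℕ → ℂ) : Prop :=
  Summable (fun n => w n * ‖a n‖ ^ 2)

/-- The norm on the weighted Hardy space `H_w`. -/
noncomputable def hardyNorm (w : ℕ → ℝ) (a : ℕ → ℂ) : ℝ :=
  Real.sqrt (∑' n, w n * ‖a n‖ ^ 2)

/-- The radius condition: `∑ rⁿ / w n` converges for every `0 ≤ r < 1`. -/
def radiusCond (w : ℕ → ℝ) : Prop :=
  ∀ r : ℝ, 0 ≤ r → r < 1 → Summable (fun n => r ^ n / w n)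

/-- The analytic function on the disk defined by a sequence of coefficients:
`â(z) = ∑ aₙ zⁿ`. -/
noncomputable def hardyHat (a : ℕ → ℂ) (z : ℂ) : ℂ := ∑' n, a n * z ^ n

theorem hardyHat_hasFPowerSeriesOnBall {w : ℕ → ℝ} (hw : ∀ n, 0 < w n) (hrw : radiusCond w)
    {a : ℕ → ℂ} (ha : memHardy w a) :
    HasFPowerSeriesOnBall (hardyHat a) (FormalMultilinearSeries.ofScalars ℂ a) 0 1 := by
  have hrad : 1 ≤ (FormalMultilinearSeries.ofScalars ℂ a).radius := by
    refine ENNReal.le_of_forall_nnreal_lt fun r hr => ?_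
    have hr1 : (r : ℝ) < 1 := by exact_mod_cast hr
    apply FormalMultilinearSeries.le_radius_of_summable_norm
    have h2 := hrw ((r : ℝ) ^ 2) (by positivity) (by nlinarith [r.2])
    refine Summable.of_nonneg_of_le (fun n => by positivity) (fun n => ?_) (ha.add h2)
    rw [FormalMultilinearSeries.ofScalars_norm]
    have hn := hw n
    set t := ‖a n‖
    set s := (r : ℝ) ^ n with hs
    have hs0 : 0 ≤ s := by positivity
    have ht0 : 0 ≤ t := norm_nonneg _
    rw [← pow_mul, mul_comm 2 n, pow_mul, ← hs]
    have hE : w n * t ^ 2 + s ^ 2 / w n - t * s = ((w n * t - s) ^ 2 + w n * t * s) / w n := by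
      field_simp
      ring
    have : 0 ≤ ((w n * t - s) ^ 2 + w n * t * s) / w n := by positivity
    linarith
  have hsum : (FormalMultilinearSeries.ofScalars ℂ a).sum = hardyHat a := by
    funext z
    simp [FormalMultilinearSeries.sum, hardyHat, mul_comm]
  rw [← hsum]
  exact (FormalMultilinearSeries.hasFPowerSeriesOnBall _ (zero_lt_one.trans_le hrad)).mono
    zero_lt_one hrad

theorem hardyHat_differentiableOn {w : ℕ → ℝ} (hw : ∀ n, 0 < w n) (hrw : radiusCond w)
    {a : ℕ → ℂ} (ha : memHardy w a) :
    DifferentiableOn ℂ (hardyHat a) (Metric.ball 0 1) := by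
  have h := (hardyHat_hasFPowerSeriesOnBall hw hrw ha).differentiableOn
  rwa [← ENNReal.ofReal_one, Metric.eball_ofReal] at h

theorem eq_of_hardyHat_eqOn {w : ℕ → ℝ} (hw : ∀ n, 0 < w n) (hrw : radiusCond w)
    {a b : ℕ → ℂ} (ha : memHardy w a) (hb : memHardy w b)
    (h : ∀ z : ℂ, ‖z‖ < 1 → hardyHat a z = hardyHat b z) : a = b := by
  apply FormalMultilinearSeries.ofScalars_series_injective (𝕜 := ℂ) ℂ
  refine (hardyHat_hasFPowerSeriesOnBall hw hrw ha).hasFPowerSeriesAt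
    |>.eq_formalMultilinearSeries_of_eventually
      (hardyHat_hasFPowerSeriesOnBall hw hrw hb).hasFPowerSeriesAt ?_
  filter_upwards [Metric.ball_mem_nhds (0 : ℂ) one_pos] with z hz
  exact h z (by simpa using hz)

/-- The coefficient sequence of `z ↦ â(η z)`. -/
def hardyRotate (η : ℂ) (a : ℕ → ℂ) : ℕ → ℂ := fun n => η ^ n * a n

theorem memHardy_rotate {w : ℕ → ℝ} {η : ℂ} (hη : ‖η‖ = 1) {a : ℕ → ℂ} (ha : memHardy w a) :
    memHardy w (hardyRotate η a) := by
  simpa [memHardy, hardyRotate, hη] using ha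

theorem hardyNorm_rotate (w : ℕ → ℝ) {η : ℂ} (hη : ‖η‖ = 1) (a : ℕ → ℂ) :
    hardyNorm w (hardyRotate η a) = hardyNorm w a := by
  simp [hardyNorm, hardyRotate, hη]

theorem hardyHat_rotate (η : ℂ) (a : ℕ → ℂ) (z : ℂ) :
    hardyHat (hardyRotate η a) z = hardyHat a (η * z) := by
  simp only [hardyHat, hardyRotate, mul_pow]
  exact tsum_congr fun n => by ring

theorem memHardy_single (w : ℕ → ℝ) (n : ℕ) (c : ℂ) : memHardy w (Pi.single n c) := by
  refine summable_of_ne_finset_zero (s := {n}) fun m hm => ?_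
  simp [Pi.single_eq_of_ne (Finset.notMem_singleton.mp hm)]

theorem hardyNorm_single (w : ℕ → ℝ) (n : ℕ) (c : ℂ) :
    hardyNorm w (Pi.single n c) = Real.sqrt (w n) * ‖c‖ := by
  rw [hardyNorm, tsum_eq_single n]
  · simp [Real.sqrt_mul' _ (sq_nonneg ‖c‖)]
  · intro m hm
    simp [Pi.single_eq_of_ne hm]

theorem hardyHat_single (n : ℕ) (c z : ℂ) : hardyHat (Pi.single n c) z = c * z ^ n := by
  rw [hardyHat, tsum_eq_single n]
  · simp
  · intro m hm
    simp [Pi.single_eq_of_ne hm]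

open Metric Set in
/-- If `χ` is holomorphic on the unit disk and vanishes at `b`, then on the circle through `b`
centred at `0` there is a point where `‖χ‖` takes its central value. -/
theorem exists_norm_rotate_eq {χ : ℂ → ℂ} (hd : DifferentiableOn ℂ χ (ball 0 1)) {b : ℂ}
    (hb : ‖b‖ < 1) (hχ : χ b = 0) : ∃ η : ℂ, ‖η‖ = 1 ∧ ‖χ (η * b)‖ = ‖χ 0‖ := by
  rcases eq_or_ne b 0 with rfl | hb0
  · exact ⟨1, by simp⟩
  have hsub : closedBall (0 : ℂ) ‖b‖ ⊆ ball 0 1 := closedBall_subset_ball hb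
  have hcont : ContinuousOn (fun z => ‖χ z‖) (sphere 0 ‖b‖) :=
    (hd.continuousOn.mono (sphere_subset_closedBall.trans hsub)).norm
  obtain ⟨y, hy, hmax⟩ := (isCompact_sphere (0 : ℂ) ‖b‖).exists_isMaxOn ⟨b, by simp⟩ hcont
  have hle : ‖χ 0‖ ≤ ‖χ y‖ := by
    refine Complex.norm_le_of_forall_mem_frontier_norm_le (U := ball 0 ‖b‖) isBounded_ball
      (DifferentiableOn.diffContOnCl ?_) (fun z hz => ?_) (subset_closure (by simpa using hb0))
    · exact hd.mono (closure_ball_subset_closedBall.trans hsub)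
    · exact hmax (frontier_ball_subset_sphere hz)
  obtain ⟨x, hx, hxe⟩ := (isPreconnected_sphere (by simp) (0 : ℂ) ‖b‖).intermediate_value
    (a := b) (by simp) hy hcont (show ‖χ 0‖ ∈ Icc _ _ from ⟨by simp [hχ], hle⟩)
  have hxb : ‖x‖ = ‖b‖ := by simpa using hx
  refine ⟨x / b, ?_, ?_⟩
  · rw [norm_div, hxb, div_self (by simpa using hb0)]
  · rw [div_mul_cancel₀ _ hb0]
    exact hxe

open Metric Set in
/-- A biholomorphism of the unit disk fixing the origin is a rotation. -/
theorem exists_rotation_of_biholomorphic {f g : ℂ → ℂ} (hf : DifferentiableOn ℂ f (ball 0 1))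
    (hg : DifferentiableOn ℂ g (ball 0 1)) (hfm : MapsTo f (ball 0 1) (ball 0 1))
    (hgm : MapsTo g (ball 0 1) (ball 0 1)) (hf0 : f 0 = 0) (hg0 : g 0 = 0)
    (hgf : ∀ z ∈ ball (0 : ℂ) 1, g (f z) = z) :
    ∃ κ : ℂ, ‖κ‖ = 1 ∧ ∀ z ∈ ball (0 : ℂ) 1, f z = κ * z := by
  have hnorm : ∀ z ∈ ball (0 : ℂ) 1, ‖f z‖ = ‖z‖ := by
    intro z hz
    refine le_antisymm
      (Complex.norm_le_norm_of_mapsTo_ball hf (hfm.mono_right ball_subset_closedBall) hf0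
        (by simpa using hz)) ?_
    conv_lhs => rw [← hgf z hz]
    exact Complex.norm_le_norm_of_mapsTo_ball hg (hgm.mono_right ball_subset_closedBall) hg0
      (by simpa using hfm hz)
  have hhalf : (1 / 2 : ℂ) ∈ ball (0 : ℂ) 1 := by
    norm_num [mem_ball_zero_iff]
  have hds : ‖dslope f 0 (1 / 2)‖ = 1 / 1 := by
    rw [dslope_of_ne _ (by norm_num), slope_def_field, hf0, norm_div, sub_zero, sub_zero,
      hnorm _ hhalf]
    norm_num
  have hfm' : MapsTo f (ball 0 1) (closedBall (f 0) 1) := by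
    rw [hf0]; exact hfm.mono_right ball_subset_closedBall
  have haff := Complex.affine_of_mapsTo_ball_of_norm_dslope_eq_div hf hfm' hhalf hds
  refine ⟨dslope f 0 (1 / 2), by simpa using hds, fun z hz => ?_⟩
  rw [haff hz, hf0]
  simp [mul_comm]

/-- Suppose `w, u` are strictly positive weight sequences satisfying the
radius condition, `φ` is a bijection of the open unit disk, `α ≠ 0` and `S : H_u → H_w` is
a continuous linear equivalence with `(S h)^(z) = α · ĥ(φ z)` for all `h ∈ H_u`, `z ∈ 𝔻`
(i.e. `S = α C_φ`).  Then `ε < wₙ/uₙ < M` for some `ε, M > 0` and all `n`. -/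
theorem statement2 (w u : ℕ → ℝ) (hw : ∀ n, 0 < w n) (hu : ∀ n, 0 < u n)
    (hrw : radiusCond w) (hru : radiusCond u)
    (φ : ℂ → ℂ) (hφ : Set.BijOn φ {z : ℂ | ‖z‖ < 1} {z : ℂ | ‖z‖ < 1})
    (α : ℂ) (hα : α ≠ 0)
    (S : (ℕ → ℂ) →ₗ[ℂ] (ℕ → ℂ))
    (hbij : Set.BijOn S {h | memHardy u h} {h | memHardy w h})
    (hbdd : ∃ C > (0 : ℝ), ∀ h, memHardy u h → hardyNorm w (S h) ≤ C * hardyNorm u h)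
    (hbdd' : ∃ c > (0 : ℝ), ∀ h, memHardy u h → c * hardyNorm u h ≤ hardyNorm w (S h))
    (hcomp : ∀ h, memHardy u h → ∀ z : ℂ, ‖z‖ < 1 →
      hardyHat (S h) z = α * hardyHat h (φ z)) :
    ∃ ε M : ℝ, 0 < ε ∧ 0 < M ∧ ∀ n, ε < w n / u n ∧ w n / u n < M := by
  obtain ⟨C, hC, hSC⟩ := hbdd
  obtain ⟨c, hc, hSc⟩ := hbdd'
  have hD : {z : ℂ | ‖z‖ < 1} = Metric.ball 0 1 := by ext; simp
  rw [hD] at hφ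
  have hcomp' : ∀ h, memHardy u h → ∀ z ∈ Metric.ball (0 : ℂ) 1,
      hardyHat (S h) z = α * hardyHat h (φ z) := fun h hh z hz => hcomp h hh z (by simpa using hz)
  have h0 : (0 : ℂ) ∈ Metric.ball (0 : ℂ) 1 := by simp
  have hrot : ∀ {η : ℂ}, ‖η‖ = 1 →
      Set.MapsTo (fun z => η * z) (Metric.ball (0 : ℂ) 1) (Metric.ball 0 1) := by
    intro η hη z hz
    simpa [hη] using hz
  -- the inverse of `φ`
  set χ := Function.invFunOn φ (Metric.ball 0 1)
  have hinv : Set.InvOn χ φ (Metric.ball 0 1) (Metric.ball 0 1) := hφ.invOn_invFunOn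
  have hχm : Set.MapsTo χ (Metric.ball 0 1) (Metric.ball 0 1) := hφ.surjOn.mapsTo_invFunOn
  have hφm := hφ.mapsTo
  have hφd : DifferentiableOn ℂ φ (Metric.ball 0 1) := by
    have hm := hbij.mapsTo (memHardy_single u 1 1)
    refine ((hardyHat_differentiableOn hw hrw hm).const_mul α⁻¹).congr fun z hz => ?_
    rw [hcomp' _ (memHardy_single u 1 1) z hz, hardyHat_single]
    field_simp
  have hχd : DifferentiableOn ℂ χ (Metric.ball 0 1) := by
    obtain ⟨h, hh, hSh⟩ := hbij.surjOn (memHardy_single w 1 1)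
    refine ((hardyHat_differentiableOn hu hru hh).const_mul α).congr fun z hz => ?_
    have := hcomp' h hh (χ z) (hχm hz)
    rw [hSh, hardyHat_single, hinv.2 hz] at this
    simpa using this
  obtain ⟨η₂, hη₂, hη₂e⟩ := exists_norm_rotate_eq hχd (b := φ 0) (by simpa using hφm h0)
    (hinv.1 h0)
  obtain ⟨η₁, hη₁, hη₁e⟩ : ∃ η : ℂ, ‖η‖ = 1 ∧ η * χ (η₂ * φ 0) = χ 0 := by
    rcases eq_or_ne (χ (η₂ * φ 0)) 0 with h | h
    · refine ⟨1, by simp, ?_⟩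
      rw [h, norm_zero] at hη₂e
      rw [h, mul_zero, norm_eq_zero.mp hη₂e.symm]
    · refine ⟨χ 0 / χ (η₂ * φ 0), ?_, div_mul_cancel₀ _ h⟩
      rw [norm_div, hη₂e, div_self]
      rw [← hη₂e]
      simpa using h
  have hη₁0 : η₁ ≠ 0 := by rintro rfl; simp at hη₁
  have hη₂0 : η₂ ≠ 0 := by rintro rfl; simp at hη₂
  have hη₁' : ‖η₁⁻¹‖ = 1 := by simp [hη₁]
  have hη₂' : ‖η₂⁻¹‖ = 1 := by simp [hη₂]
  have hrd : ∀ η : ℂ, DifferentiableOn ℂ (fun z => η * z) (Metric.ball 0 1) :=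
    fun η => by fun_prop
  obtain ⟨κ, hκ, hκe⟩ := exists_rotation_of_biholomorphic
    (f := φ ∘ (fun z => η₁ * z) ∘ χ ∘ (fun z => η₂ * z) ∘ φ)
    (g := χ ∘ (fun z => η₂⁻¹ * z) ∘ φ ∘ (fun z => η₁⁻¹ * z) ∘ χ)
    (hφd.comp ((hrd _).comp (hχd.comp ((hrd _).comp hφd hφm) ((hrot hη₂).comp hφm))
      (hχm.comp ((hrot hη₂).comp hφm))) ((hrot hη₁).comp (hχm.comp ((hrot hη₂).comp hφm))))
    (hχd.comp ((hrd _).comp (hφd.comp ((hrd _).comp hχd hχm) ((hrot hη₁').comp hχm))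
      (hφm.comp ((hrot hη₁').comp hχm))) ((hrot hη₂').comp (hφm.comp ((hrot hη₁').comp hχm))))
    (hφm.comp ((hrot hη₁).comp (hχm.comp ((hrot hη₂).comp hφm))))
    (hχm.comp ((hrot hη₂').comp (hφm.comp ((hrot hη₁').comp hχm))))
    (by simp only [Function.comp_apply]; rw [hη₁e, hinv.2 h0])
    (by
      simp only [Function.comp_apply]
      rw [← hη₁e, inv_mul_cancel_left₀ hη₁0, hinv.2 (hrot hη₂ (hφm h0)),
        inv_mul_cancel_left₀ hη₂0, hinv.1 h0])
    (by
      intro z hz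
      have h1 := hrot hη₂ (hφm hz)
      simp only [Function.comp_apply]
      rw [hinv.1 (hrot hη₁ (hχm h1)), inv_mul_cancel_left₀ hη₁0, hinv.2 h1,
        inv_mul_cancel_left₀ hη₂0, hinv.1 hz])
  simp only [Function.comp_apply] at hκe
  have key : ∀ n, c ^ 2 * √(u n) ≤ C * (√(w n) * ‖α‖) ∧ c * (√(w n) * ‖α‖) ≤ C ^ 2 * √(u n) := by
    intro n
    have he := memHardy_single u n 1
    have hSe := hbij.mapsTo he
    obtain ⟨h, hh, hSh⟩ := hbij.surjOn (memHardy_rotate hη₁ hSe)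
    have hh' := memHardy_rotate hη₂ hh
    have heq : S (hardyRotate η₂ h) = Pi.single n (α * κ ^ n) := by
      refine eq_of_hardyHat_eqOn hw hrw (hbij.mapsTo hh') (memHardy_single w n _) fun z hz => ?_
      replace hz : z ∈ Metric.ball (0 : ℂ) 1 := by simpa using hz
      have h1 := hrot hη₂ (hφm hz)
      have h2 := hcomp' h hh _ (hχm h1)
      rw [hSh, hardyHat_rotate, hcomp' _ he _ (hrot hη₁ (hχm h1)), hκe z hz, hardyHat_single,
        hinv.2 h1] at h2
      rw [hcomp' _ hh' z hz, hardyHat_rotate, ← h2, hardyHat_single]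
      ring
    have e1 := hSC _ he
    have e2 := hSc _ he
    have e3 := hSC _ hh
    have e4 := hSc _ hh
    have e5 := hSC _ hh'
    have e6 := hSc _ hh'
    rw [hSh, hardyNorm_rotate _ hη₁] at e3 e4
    rw [heq, hardyNorm_rotate _ hη₂, hardyNorm_single] at e5 e6
    rw [hardyNorm_single] at e1 e2
    simp only [norm_mul, norm_pow, hκ, one_pow, mul_one, norm_one] at e1 e2 e5 e6
    constructor <;> nlinarith
  have hα' : 0 < ‖α‖ := norm_pos_iff.mpr hα
  refine ⟨(c ^ 2 / (C * ‖α‖)) ^ 2 / 2, (C ^ 2 / (c * ‖α‖)) ^ 2 + 1, by positivity, by positivity,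
    fun n => ?_⟩
  have hun := Real.sqrt_pos.mpr (hu n)
  have hratio : w n / u n = (√(w n) / √(u n)) ^ 2 := by
    rw [div_pow, Real.sq_sqrt (hw n).le, Real.sq_sqrt (hu n).le]
  obtain ⟨hlow, hup⟩ := key n
  have hlow' : c ^ 2 / (C * ‖α‖) ≤ √(w n) / √(u n) := by
    rw [div_le_div_iff₀ (by positivity) hun]
    linarith
  have hup' : √(w n) / √(u n) ≤ C ^ 2 / (c * ‖α‖) := by
    rw [div_le_div_iff₀ hun (by positivity)]
    linarith
  rw [hratio]
  constructor
  · exact (half_lt_self (by positivity)).trans_le (by gcongr)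
  · exact lt_of_le_of_lt (by gcongr) (lt_add_one _)
end

section
/- (Disk trick.) Let w, u : ℕ → ℝ be strictly positive weight sequences, both satisfying the radius condition. Suppose there exist a bijection φ : 𝔻 → 𝔻 of the open unit disk and a continuous linear equivalence S : H_w → H_u such that (S h)^(z) = ĥ(φ(z)) for every h ∈ H_w and z ∈ 𝔻 (i.e., S is the composition operator C_φ and it is an isomorphism). Then there exist a bijection φ' : 𝔻 → 𝔻 with φ'(0) = 0 and a continuous linear equivalence S' : H_w → H_u such that (S' h)^(z) = ĥ(φ'(z)) for every h ∈ H_w and z ∈ 𝔻. -/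
/-- `S` is a continuous linear equivalence (bounded bijective linear map with bounded
inverse) from `H_w` onto `H_u` which acts as the composition operator `C_φ`. -/
def IsCompositionIso (w u : ℕ → ℝ) (S : (ℕ → ℂ) →ₗ[ℂ] (ℕ → ℂ)) (φ : ℂ → ℂ) : Prop :=
  Set.BijOn S {h | memHardy w h} {h | memHardy u h} ∧
  (∃ C > (0 : ℝ), ∀ h, memHardy w h → hardyNorm u (S h) ≤ C * hardyNorm w h) ∧
  (∃ c > (0 : ℝ), ∀ h, memHardy w h → c * hardyNorm w h ≤ hardyNorm u (S h)) ∧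
  (∀ h, memHardy w h → ∀ z : ℂ, ‖z‖ < 1 → hardyHat (S h) z = hardyHat h (φ z))

/-- The submodule of sequences in `H_w`. -/
def hardySubmodule (w : ℕ → ℝ) (hw : ∀ n, 0 < w n) : Submodule ℂ (ℕ → ℂ) where
  carrier := {h | memHardy w h}
  zero_mem' := by simp [memHardy]
  add_mem' := by
    intro a b ha hb
    have ha' : Summable (fun n => w n * ‖a n‖ ^ 2) := ha
    have hb' : Summable (fun n => w n * ‖b n‖ ^ 2) := hb
    refine Summable.of_nonneg_of_le (fun n => mul_nonneg (hw n).le (sq_nonneg _)) (fun n => ?_)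
      ((ha'.add hb').mul_left 2)
    have h1 : ‖(a + b) n‖ ^ 2 ≤ 2 * (‖a n‖ ^ 2 + ‖b n‖ ^ 2) :=
      (pow_le_pow_left₀ (norm_nonneg _) (norm_add_le (a n) (b n)) 2).trans
        (by nlinarith [sq_nonneg (‖a n‖ - ‖b n‖)])
    calc w n * ‖(a + b) n‖ ^ 2 ≤ w n * (2 * (‖a n‖ ^ 2 + ‖b n‖ ^ 2)) :=
          mul_le_mul_of_nonneg_left h1 (hw n).le
      _ = 2 * (w n * ‖a n‖ ^ 2 + w n * ‖b n‖ ^ 2) := by ring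
  smul_mem' := by
    intro c a ha
    have ha' : Summable (fun n => w n * ‖a n‖ ^ 2) := ha
    refine (ha'.mul_left (‖c‖ ^ 2)).congr fun n => ?_
    simp only [Pi.smul_apply, smul_eq_mul, norm_mul]
    ring

/-- The sequence whose associated function is the identity. -/
def hardyId : ℕ → ℂ := Pi.single 1 1

lemma memHardy_hardyId (w : ℕ → ℝ) : memHardy w hardyId := by
  refine summable_of_ne_finset_zero (s := {1}) fun n hn => ?_
  have : n ≠ 1 := by simpa using hn
  simp [hardyId, this]

lemma hardyHat_hardyId (z : ℂ) : hardyHat hardyId z = z := by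
  unfold hardyHat
  rw [tsum_eq_single 1]
  · simp [hardyId]
  · intro n hn
    simp [hardyId, hn]

lemma summable_norm_mul_pow {w : ℕ → ℝ} (hw : ∀ n, 0 < w n) (hrw : radiusCond w) {a : ℕ → ℂ}
    (ha : memHardy w a) {r : ℝ} (h0 : 0 ≤ r) (h1 : r < 1) :
    Summable (fun n => ‖a n‖ * r ^ n) := by
  have ha' : Summable (fun n => w n * ‖a n‖ ^ 2) := ha
  have hr := hrw (r ^ 2) (sq_nonneg r) (by nlinarith)
  refine Summable.of_nonneg_of_le (fun n => by positivity) (fun n => ?_) (ha'.add hr)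
  have hn := hw n
  have hs : 0 ≤ w n * (‖a n‖ - r ^ n / w n) ^ 2 := by positivity
  have e : w n * (‖a n‖ - r ^ n / w n) ^ 2
      = w n * ‖a n‖ ^ 2 - 2 * (‖a n‖ * r ^ n) + (r ^ 2) ^ n / w n := by
    field_simp
    ring
  have : 0 ≤ ‖a n‖ * r ^ n := by positivity
  linarith

lemma differentiableOn_hardyHat {w : ℕ → ℝ} (hw : ∀ n, 0 < w n) (hrw : radiusCond w)
    {a : ℕ → ℂ} (ha : memHardy w a) :
    DifferentiableOn ℂ (hardyHat a) {z : ℂ | ‖z‖ < 1} := by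
  intro z hz
  obtain ⟨r, hzr, hr1⟩ := exists_between (show ‖z‖ < 1 from hz)
  have hr0 : 0 ≤ r := (norm_nonneg z).trans hzr.le
  have hd : DifferentiableOn ℂ (hardyHat a) (Metric.ball 0 r) := by
    refine Complex.differentiableOn_tsum_of_summable_norm
      (summable_norm_mul_pow hw hrw ha hr0 hr1) (fun n => by fun_prop) Metric.isOpen_ball ?_
    intro n y hy
    rw [norm_mul, norm_pow]
    have : ‖y‖ ≤ r := (mem_ball_zero_iff.1 hy).le
    gcongr
  exact (hd.differentiableAt
    (Metric.isOpen_ball.mem_nhds (mem_ball_zero_iff.2 hzr))).differentiableWithinAt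

namespace IsCompositionIso

lemma comp {w u v : ℕ → ℝ} {S T : (ℕ → ℂ) →ₗ[ℂ] (ℕ → ℂ)} {φ ψ : ℂ → ℂ}
    (hT : IsCompositionIso u v T ψ) (hS : IsCompositionIso w u S φ)
    (hψ : Set.MapsTo ψ {z : ℂ | ‖z‖ < 1} {z : ℂ | ‖z‖ < 1}) :
    IsCompositionIso w v (T ∘ₗ S) (φ ∘ ψ) := by
  obtain ⟨hT1, ⟨C, hC, hT2⟩, ⟨c, hc, hT3⟩, hT4⟩ := hT
  obtain ⟨hS1, ⟨C', hC', hS2⟩, ⟨c', hc', hS3⟩, hS4⟩ := hS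
  refine ⟨by simpa using hT1.comp hS1, ⟨C * C', by positivity, fun h hh => ?_⟩,
    ⟨c * c', by positivity, fun h hh => ?_⟩, fun h hh z hz => ?_⟩
  · rw [mul_assoc]
    exact (hT2 _ (hS1.mapsTo hh)).trans (mul_le_mul_of_nonneg_left (hS2 h hh) hC.le)
  · rw [mul_assoc]
    exact (mul_le_mul_of_nonneg_left (hS3 h hh) hc.le).trans (hT3 _ (hS1.mapsTo hh))
  · exact (hT4 _ (hS1.mapsTo hh) z hz).trans (hS4 h hh _ (hψ hz))

lemma exists_inverse {w u : ℕ → ℝ} (hw : ∀ n, 0 < w n) (hu : ∀ n, 0 < u n)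
    {S : (ℕ → ℂ) →ₗ[ℂ] (ℕ → ℂ)} {φ ψ : ℂ → ℂ} (hS : IsCompositionIso w u S φ)
    (hψ : Set.MapsTo ψ {z : ℂ | ‖z‖ < 1} {z : ℂ | ‖z‖ < 1})
    (hφψ : Set.RightInvOn ψ φ {z : ℂ | ‖z‖ < 1}) :
    ∃ T : (ℕ → ℂ) →ₗ[ℂ] (ℕ → ℂ), IsCompositionIso u w T ψ := by
  obtain ⟨hS1, ⟨C, hC, hS2⟩, ⟨c, hc, hS3⟩, hS4⟩ := hS
  let R : hardySubmodule w hw →ₗ[ℂ] hardySubmodule u hu :=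
    S.restrict (p := hardySubmodule w hw) (q := hardySubmodule u hu) fun _ hx => hS1.mapsTo hx
  have hR : Function.Bijective R := by
    constructor
    · intro x y hxy
      exact Subtype.ext (hS1.injOn x.2 y.2 (congrArg Subtype.val hxy))
    · rintro ⟨y, hy⟩
      obtain ⟨x, hx, hxy⟩ := hS1.surjOn hy
      exact ⟨⟨x, hx⟩, Subtype.ext hxy⟩
  let E := LinearEquiv.ofBijective R hR
  obtain ⟨T, hT⟩ := LinearMap.exists_extend
    ((hardySubmodule w hw).subtype ∘ₗ E.symm.toLinearMap)
  have hT' : ∀ g (hg : memHardy u g), T g = E.symm ⟨g, hg⟩ := fun g hg =>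
    LinearMap.congr_fun hT ⟨g, hg⟩
  have hTm : ∀ g, memHardy u g → memHardy w (T g) := fun g hg => by
    rw [hT' g hg]
    exact (E.symm ⟨g, hg⟩).2
  have hST : ∀ g, memHardy u g → S (T g) = g := fun g hg => by
    rw [hT' g hg]
    exact congrArg Subtype.val (E.apply_symm_apply ⟨g, hg⟩)
  have hTS : ∀ h, memHardy w h → T (S h) = h := fun h hh =>
    hS1.injOn (hTm _ (hS1.mapsTo hh)) hh (hST _ (hS1.mapsTo hh))
  refine ⟨T, Set.InvOn.bijOn ⟨hST, hTS⟩ hTm hS1.mapsTo, ⟨c⁻¹, by positivity, fun g hg => ?_⟩,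
    ⟨C⁻¹, by positivity, fun g hg => ?_⟩, fun g hg z hz => ?_⟩
  · have := hS3 _ (hTm g hg)
    rw [hST g hg] at this
    rwa [inv_mul_eq_div, le_div_iff₀' hc]
  · have := hS2 _ (hTm g hg)
    rw [hST g hg] at this
    rwa [inv_mul_eq_div, div_le_iff₀' hC]
  · have := hS4 _ (hTm g hg) (ψ z) (hψ hz)
    rw [hST g hg, hφψ hz] at this
    exact this.symm

lemma differentiableOn {w u : ℕ → ℝ} (hu : ∀ n, 0 < u n) (hru : radiusCond u)
    {S : (ℕ → ℂ) →ₗ[ℂ] (ℕ → ℂ)} {φ : ℂ → ℂ} (hS : IsCompositionIso w u S φ) :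
    DifferentiableOn ℂ φ {z : ℂ | ‖z‖ < 1} := by
  refine (differentiableOn_hardyHat hu hru (hS.1.mapsTo (memHardy_hardyId w))).congr ?_
  intro z hz
  rw [hS.2.2.2 _ (memHardy_hardyId w) z hz, hardyHat_hardyId]

end IsCompositionIso

lemma bijOn_rotation {c : ℂ} (hc : ‖c‖ = 1) :
    Set.BijOn (fun z => c * z) {z : ℂ | ‖z‖ < 1} {z : ℂ | ‖z‖ < 1} := by
  have hc0 : c ≠ 0 := norm_ne_zero_iff.1 (by simp [hc])
  refine Set.InvOn.bijOn (f' := fun z => c⁻¹ * z) ⟨?_, ?_⟩ ?_ ?_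
  · intro z _
    simp [hc0]
  · intro z _
    simp [hc0]
  · intro z hz
    simpa [hc] using hz
  · intro z hz
    simpa [hc] using hz

/-- Rotations of the disk act on every weighted Hardy space by invertible isometries. -/
lemma exists_isCompositionIso_rotation (w : ℕ → ℝ) {c : ℂ} (hc : ‖c‖ = 1) :
    ∃ R : (ℕ → ℂ) →ₗ[ℂ] (ℕ → ℂ), IsCompositionIso w w R (fun z => c * z) := by
  have hc0 : c ≠ 0 := norm_ne_zero_iff.1 (by simp [hc])
  have hmem : ∀ d : ℂ, ‖d‖ = 1 → ∀ h, memHardy w h → memHardy w ((fun n => d ^ n) * h) := by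
    intro d hd h hh
    refine Summable.congr hh fun n => ?_
    simp [hd]
  have hnorm : ∀ h, hardyNorm w ((fun n => c ^ n) * h) = hardyNorm w h := by
    intro h
    simp [hardyNorm, hc]
  refine ⟨LinearMap.mulLeft ℂ (fun n => c ^ n), ?_, ⟨1, one_pos, fun h _ => ?_⟩,
    ⟨1, one_pos, fun h _ => ?_⟩, fun h _ z _ => ?_⟩
  · refine Set.InvOn.bijOn (f' := fun h => (fun n => c⁻¹ ^ n) * h) ⟨?_, ?_⟩ (hmem c hc)
      (hmem c⁻¹ (by simp [hc]))
    · intro h _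
      ext n
      simp [hc0]
    · intro h _
      ext n
      simp [hc0]
  · rw [LinearMap.mulLeft_apply, hnorm, one_mul]
  · rw [LinearMap.mulLeft_apply, hnorm, one_mul]
  · refine tsum_congr fun n => ?_
    simp only [LinearMap.mulLeft_apply, Pi.mul_apply, mul_pow]
    ring

/-- A holomorphic function on the disk that vanishes at `a` takes, somewhere on the circle
through `a`, a value of the same modulus as its value at the origin. -/
lemma exists_norm_eq_norm_zero {ψ : ℂ → ℂ} (hψ : DifferentiableOn ℂ ψ {z : ℂ | ‖z‖ < 1})
    {a : ℂ} (ha : ‖a‖ < 1) (ha0 : ψ a = 0) :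
    ∃ c : ℂ, ‖c‖ = 1 ∧ ‖ψ (c * a)‖ = ‖ψ 0‖ := by
  rcases eq_or_ne a 0 with rfl | hne
  · exact ⟨1, by simp, by simp⟩
  have hapos : 0 < ‖a‖ := norm_pos_iff.2 hne
  have hcl : closure (Metric.ball (0 : ℂ) ‖a‖) ⊆ {z : ℂ | ‖z‖ < 1} := by
    rw [closure_ball _ hapos.ne']
    intro z hz
    exact (mem_closedBall_zero_iff.1 hz).trans_lt ha
  obtain ⟨p, hp, hmax⟩ := Complex.exists_mem_frontier_isMaxOn_norm Metric.isBounded_ball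
    ⟨0, Metric.mem_ball_self hapos⟩ (DiffContOnCl.mk (hψ.mono (subset_closure.trans hcl))
      (hψ.continuousOn.mono hcl))
  rw [frontier_ball _ hapos.ne', mem_sphere_zero_iff_norm] at hp
  have h0 : ‖ψ 0‖ ≤ ‖ψ p‖ := hmax (subset_closure (Metric.mem_ball_self hapos))
  have hrot : ∀ θ : ℝ, ‖Complex.exp (θ * Complex.I) * a‖ < 1 := fun θ => by
    rwa [norm_mul, Complex.norm_exp_ofReal_mul_I, one_mul]
  have hcont : Continuous fun θ : ℝ => ‖ψ (Complex.exp (θ * Complex.I) * a)‖ :=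
    (hψ.continuousOn.comp_continuous (by fun_prop) hrot).norm
  have hpa : Complex.exp ((p / a).arg * Complex.I) * a = p := by
    have := Complex.norm_mul_exp_arg_mul_I (p / a)
    rw [norm_div, hp, div_self hapos.ne', Complex.ofReal_one, one_mul] at this
    rw [this, div_mul_cancel₀ _ hne]
  obtain ⟨θ, hθ⟩ := mem_range_of_exists_le_of_exists_ge hcont
    (c := ‖ψ 0‖) ⟨0, by simp [ha0]⟩ ⟨(p / a).arg, by rw [hpa]; exact h0⟩
  exact ⟨_, Complex.norm_exp_ofReal_mul_I θ, hθ⟩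

lemma exists_norm_one_mul_eq {x y : ℂ} (h : ‖x‖ = ‖y‖) : ∃ d : ℂ, ‖d‖ = 1 ∧ d * x = y := by
  rcases eq_or_ne x 0 with rfl | hx
  · exact ⟨1, by simp, by simpa [eq_comm] using h⟩
  · exact ⟨y / x, by rw [norm_div, ← h, div_self (norm_ne_zero_iff.2 hx)],
      div_mul_cancel₀ _ hx⟩

/-- **disk trick.** If `w, u` are strictly positive weight sequences
satisfying the radius condition and `H_w ≅ H_u` via a composition operator `C_φ` with
`φ` a bijection of the open unit disk, then `H_w ≅ H_u` via a composition operator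
`C_φ'` with `φ'` a bijection of the disk fixing the origin. -/
theorem statement4 (w u : ℕ → ℝ) (hw : ∀ n, 0 < w n) (hu : ∀ n, 0 < u n)
    (hrw : radiusCond w) (hru : radiusCond u)
    (φ : ℂ → ℂ) (hφ : Set.BijOn φ {z : ℂ | ‖z‖ < 1} {z : ℂ | ‖z‖ < 1})
    (S : (ℕ → ℂ) →ₗ[ℂ] (ℕ → ℂ)) (hS : IsCompositionIso w u S φ) :
    ∃ φ' : ℂ → ℂ, Set.BijOn φ' {z : ℂ | ‖z‖ < 1} {z : ℂ | ‖z‖ < 1} ∧ φ' 0 = 0 ∧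
      ∃ S' : (ℕ → ℂ) →ₗ[ℂ] (ℕ → ℂ), IsCompositionIso w u S' φ' := by
  obtain ⟨ψ, hφψ⟩ : ∃ ψ : ℂ → ℂ, Set.InvOn ψ φ {z : ℂ | ‖z‖ < 1} {z : ℂ | ‖z‖ < 1} :=
    ⟨_, hφ.invOn_invFunOn⟩
  have hψ : Set.BijOn ψ {z : ℂ | ‖z‖ < 1} {z : ℂ | ‖z‖ < 1} := hφ.symm hφψ.symm
  obtain ⟨T, hT⟩ := hS.exists_inverse hw hu hψ.mapsTo hφψ.2
  have h0 : (0 : ℂ) ∈ {z : ℂ | ‖z‖ < 1} := by simp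
  obtain ⟨c, hc, hcn⟩ := exists_norm_eq_norm_zero (hT.differentiableOn hw hrw)
    (hφ.mapsTo h0) (hφψ.1 h0)
  obtain ⟨d, hd, hdn⟩ := exists_norm_one_mul_eq hcn
  obtain ⟨Rc, hRc⟩ := exists_isCompositionIso_rotation w hc
  obtain ⟨Rd, hRd⟩ := exists_isCompositionIso_rotation u hd
  have hc' := bijOn_rotation hc
  have hd' := bijOn_rotation hd
  refine ⟨φ ∘ (fun z => d * z) ∘ ψ ∘ (fun z => c * z) ∘ φ,
    hφ.comp (hd'.comp (hψ.comp (hc'.comp hφ))), ?_, _,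
    hS.comp (hRc.comp (hT.comp (hRd.comp hS hd'.mapsTo) hψ.mapsTo) hc'.mapsTo) hφ.mapsTo⟩
  simp only [Function.comp_apply]
  rw [hdn]
  exact hφψ.2 h0
end
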